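/- Let A ⊃ B be unital C*-algebras with a conditional expectation E : A → B satisfying x ≤ λE(x) for all x ∈ A₊. If B is simple, then the center Z(A) is finite dimensional and A is a finite direct sum of simple closed two-sided ideals. -/

import Mathlib

section helpers
variable {A : Type*} [CStarAlgebra A] [PartialOrder A] [StarOrderedRing A]

lemma aux_cfc_mem (B : StarSubalgebra ℂ A) (hB : IsClosed (B : Set A)) (f : ℝ → ℝ) (b : A)
    (hb : b ∈ B) : cfc f b ∈ B := by
  by_cases hbs : IsSelfAdjoint b
  · rw [cfc_real_eq_complex f hbs]
    exact StarAlgebra.elemental.le_of_mem hB hb (cfc_mem_elemental _ _)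
  · rw [cfc_apply_of_not_predicate b hbs]; exact zero_mem B

lemma aux_sq_add (a b : A) : star (a + b) * (a + b) ≤ (2:ℝ) • (star a * a) + (2:ℝ) • (star b * b) := by
  have h := star_mul_self_nonneg (a - b)
  rw [← sub_nonneg]
  convert h using 1
  simp only [star_add, star_sub, two_smul]
  noncomm_ring

lemma aux_le_norm {a : A} (ha : 0 ≤ a) : a ≤ algebraMap ℝ A ‖a‖ :=
  (IsSelfAdjoint.of_nonneg ha).le_algebraMap_norm_self

/-- Key lemma -/
lemma aux_key [Nontrivial A]
    (B : StarSubalgebra ℂ A) (hB : IsClosed (B : Set A))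
    (hBsimple : ∀ I : TwoSidedIdeal B, IsClosed (I : Set B) → I = ⊥ ∨ I = ⊤)
    (E : A →L[ℂ] A)
    (hrange : ∀ x : A, E x ∈ B)
    (hleft : ∀ b ∈ B, ∀ x : A, E (b * x) = b * E x)
    (hright : ∀ b ∈ B, ∀ x : A, E (x * b) = E x * b)
    (hpos : ∀ x : A, 0 ≤ x → 0 ≤ E x)
    (I : TwoSidedIdeal A) (u : A) (huI : u ∈ I) (hu0 : 0 ≤ u) (hu1 : u ≤ 1)
    (t : ℝ) (ht : t < ‖E u‖) :
    ∃ v ∈ I, 0 ≤ v ∧ v ≤ 1 ∧ algebraMap ℝ A t ≤ E v := by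
  classical
  -- the cone T
  let T : A → Prop := fun s => s ∈ B ∧ ∃ v ∈ I, 0 ≤ v ∧ v ≤ s ∧ t • s ≤ E v
  have Tadd : ∀ s s', T s → T s' → T (s + s') := by
    rintro s s' ⟨hs, v, hv, h0, h1, h2⟩ ⟨hs', v', hv', h0', h1', h2'⟩
    refine ⟨add_mem hs hs', v + v', I.add_mem hv hv', add_nonneg h0 h0', add_le_add h1 h1', ?_⟩
    rw [smul_add, map_add]; exact add_le_add h2 h2'
  have Tconj : ∀ s, T s → ∀ c ∈ B, T (star c * s * c) := by
    rintro s ⟨hs, v, hv, h0, h1, h2⟩ c hc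
    refine ⟨mul_mem (mul_mem (star_mem hc) hs) hc, star c * v * c,
      I.mul_mem_right _ _ (I.mul_mem_left _ _ hv), star_left_conjugate_nonneg h0 c,
      star_left_conjugate_le_conjugate h1 c, ?_⟩
    rw [hright c hc, hleft _ (star_mem hc)]
    have := star_left_conjugate_le_conjugate h2 c
    simpa using this
  have Tsmul : ∀ s, T s → ∀ r : ℝ, T ((r ^ 2) • s) := by
    intro s hs r
    have := Tconj s hs (algebraMap ℂ A r) (B.algebraMap_mem _)
    convert this using 1
    rw [← algebraMap_star_comm, mul_assoc, ← Algebra.commutes, ← mul_assoc, ← map_mul, ← Algebra.smul_def]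
    simp only [RCLike.star_def, Complex.conj_ofReal, ← Complex.ofReal_mul, Complex.coe_smul, pow_two]
  have T0 : T 0 := ⟨zero_mem _, 0, I.zero_mem, le_rfl, le_rfl, by simp⟩
  let Q : A → Prop := fun a => ∃ s, T s ∧ star a * a ≤ s
  have Qadd : ∀ a b, Q a → Q b → Q (a + b) := by
    rintro a b ⟨s, hs, h⟩ ⟨s', hs', h'⟩
    refine ⟨(Real.sqrt 2 ^ 2) • s + (Real.sqrt 2 ^ 2) • s', Tadd _ _ (Tsmul _ hs _) (Tsmul _ hs' _), ?_⟩
    rw [Real.sq_sqrt (by norm_num)]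
    refine (aux_sq_add a b).trans ?_
    exact add_le_add (smul_le_smul_of_nonneg_left h (by norm_num))
      (smul_le_smul_of_nonneg_left h' (by norm_num))
  have Qneg : ∀ a, Q a → Q (-a) := by
    rintro a ⟨s, hs, h⟩
    exact ⟨s, hs, by simpa using h⟩
  have Qleft : ∀ x a, Q a → Q (x * a) := by
    rintro x a ⟨s, hs, h⟩
    refine ⟨(‖x‖ ^ 2) • s, Tsmul _ hs _, ?_⟩
    have h1 := star_left_conjugate_le_conjugate (CStarAlgebra.star_mul_le_algebraMap_norm_sq (a := x)) a
    calc star (x * a) * (x * a) = star a * (star x * x) * a := by simp only [star_mul]; noncomm_ring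
      _ ≤ _ := h1
      _ = (‖x‖ ^ 2) • (star a * a) := by
        rw [← Algebra.commutes, mul_assoc, ← Algebra.smul_def]
      _ ≤ _ := smul_le_smul_of_nonneg_left h (by positivity)
  have Qright : ∀ x ∈ B, ∀ a, Q a → Q (a * x) := by
    rintro x hx a ⟨s, hs, h⟩
    refine ⟨star x * s * x, Tconj _ hs x hx, ?_⟩
    have := star_left_conjugate_le_conjugate h x
    simpa [mul_assoc] using this
  -- the element g
  have hb0 := hpos u hu0
  have hbB := hrange u
  set b := E u with hb
  have hbs : IsSelfAdjoint b := .of_nonneg hb0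
  let f : ℝ → ℝ := fun x => Real.sqrt (max (x - t) 0)
  have hf : Continuous f := by fun_prop
  let g := cfc f b
  have hgB : g ∈ B := aux_cfc_mem B hB f b hbB
  have hgs : star g = g := (cfc_predicate f b : IsSelfAdjoint _).star_eq
  have hgg : g * g = cfc (fun x => f x * f x) b := (cfc_mul f f b hf.continuousOn hf.continuousOn).symm
  have hgbg : g * b * g = cfc (fun x => f x * x * f x) b := by
    rw [cfc_mul (fun x => f x * x) f b (by fun_prop) (by fun_prop), cfc_mul f (fun x => x) b (by fun_prop) (by fun_prop), cfc_id' ℝ b]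
  have hg0 : g ≠ 0 := by
    intro h
    have h1 := cfc_map_spectrum f b
    have h2 : f ‖b‖ ∈ spectrum ℝ g := by
      rw [show g = cfc f b from rfl, h1]
      exact ⟨_, CStarAlgebra.norm_mem_spectrum_of_nonneg hb0, rfl⟩
    rw [h, spectrum.zero_eq] at h2
    have : 0 < f ‖b‖ := Real.sqrt_pos.2 (lt_max_of_lt_left (by linarith))
    simp at h2
    linarith
  have Tg : T (g * g) := by
    refine ⟨mul_mem hgB hgB, g * u * g, I.mul_mem_right _ _ (I.mul_mem_left _ _ huI), ?_, ?_, ?_⟩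
    · have := star_left_conjugate_nonneg hu0 g
      rwa [hgs] at this
    · have := star_left_conjugate_le_conjugate hu1 g
      rwa [hgs, mul_one] at this
    · rw [hright g hgB, hleft g hgB, ← hb, hgbg, hgg, ← cfc_smul t _ b (by fun_prop)]
      refine cfc_mono (fun x _ => ?_) (by fun_prop) (by fun_prop)
      simp only [f, smul_eq_mul]
      rw [mul_right_comm, Real.mul_self_sqrt (le_max_right _ _), mul_comm]
      rcases le_total (x - t) 0 with h | h
      · simp [max_eq_right h]
      · rw [max_eq_left h]; nlinarith
  have Qg : Q g := ⟨_, Tg, by rw [hgs]⟩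
  -- the closed ideal of B
  let C : Set B := {a | Q (a : A)}
  have clos2 : ∀ {x y : B}, x ∈ closure C → y ∈ closure C → x + y ∈ closure C := fun hx hy =>
    map_mem_closure₂ continuous_add hx hy (fun a ha b hb => Qadd _ _ ha hb)
  let J : TwoSidedIdeal B := TwoSidedIdeal.mk' (closure C)
    (subset_closure (⟨0, T0, by simp⟩ : Q ((0 : B) : A)))
    clos2
    (fun {x} hx => map_mem_closure continuous_neg hx (fun a ha => Qneg _ ha))
    (fun {x y} hy => map_mem_closure (f := fun z => x * z) (continuous_const_mul x) hy (fun a ha => Qleft _ _ ha))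
    (fun {x y} hx => map_mem_closure (f := fun z => z * y) (continuous_mul_const y) hx (fun a ha => Qright _ y.2 _ ha))
  have hJ : (J : Set B) = closure C := TwoSidedIdeal.coe_mk' ..
  have hJ1 : (1 : B) ∈ closure C := by
    rcases hBsimple J (by rw [hJ]; exact isClosed_closure) with h | h
    · exfalso
      have : (⟨g, hgB⟩ : B) ∈ (J : Set B) := by
        rw [hJ]; exact subset_closure Qg
      rw [h] at this
      have h3 : (⟨g, hgB⟩ : B) = 0 := by simpa using this
      exact hg0 (congrArg Subtype.val h3)
    · rw [← hJ, h]; trivial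
  obtain ⟨a, ha, hda⟩ := Metric.mem_closure_iff.1 hJ1 (1/2) (by norm_num)
  obtain ⟨s, hs, has⟩ := ha
  have hna : ‖(1 : A) - a‖ < 1/2 := by
    rw [dist_eq_norm] at hda; simpa using hda
  have hs1 : algebraMap ℝ A (1/4) ≤ s := by
    have h1 := aux_sq_add (a : A) (1 - a)
    have h2 : star (1 - (a:A)) * (1 - a) ≤ algebraMap ℝ A (1/4) := by
      refine CStarAlgebra.star_mul_le_algebraMap_norm_sq.trans ?_
      refine algebraMap_mono A ?_
      nlinarith [norm_nonneg ((1:A) - a)]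
    have h3 : (1 : A) ≤ (2:ℝ) • s + (2:ℝ) • algebraMap ℝ A (1/4) := by
      refine le_trans ?_ (add_le_add (smul_le_smul_of_nonneg_left has (by norm_num : (0:ℝ) ≤ 2)) (smul_le_smul_of_nonneg_left h2 (by norm_num : (0:ℝ) ≤ 2)))
      refine le_trans (le_of_eq ?_) h1
      simp
    have h4 := smul_le_smul_of_nonneg_left h3 (by norm_num : (0:ℝ) ≤ 1/2)
    rw [← sub_nonneg] at h4 ⊢
    convert h4 using 1
    simp only [Algebra.algebraMap_eq_smul_one]
    module
  obtain ⟨hsB, v, hvI, hv0, hvs, hvE⟩ := hs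
  have hs0 : 0 ≤ s := hv0.trans hvs
  have hss : IsSelfAdjoint s := .of_nonneg hs0
  have hsp : ∀ x ∈ spectrum ℝ s, 1/4 ≤ x := (algebraMap_le_iff_le_spectrum (a := s) (r := (1/4:ℝ))).1 hs1
  let k : ℝ → ℝ := fun x => (Real.sqrt x)⁻¹
  have hk : ContinuousOn k (spectrum ℝ s) := by
    refine ContinuousOn.inv₀ (by fun_prop) (fun x hx => ?_)
    have := hsp x hx
    exact (Real.sqrt_pos.2 (by linarith)).ne'
  let r := cfc k s
  have hrB : r ∈ B := aux_cfc_mem B hB k s hsB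
  have hrs : star r = r := (cfc_predicate k s : IsSelfAdjoint _).star_eq
  have hrsr : r * s * r = 1 := by
    have : r * s * r = cfc (fun x => k x * x * k x) s := by
      rw [cfc_mul (fun x => k x * x) k s (hk.mul (by fun_prop)) hk, cfc_mul k (fun x => x) s hk (by fun_prop), cfc_id' ℝ s]
    rw [this, ← cfc_one ℝ s]
    refine cfc_congr (fun x hx => ?_)
    have h := hsp x hx
    have h1 : 0 < Real.sqrt x := Real.sqrt_pos.2 (by linarith)
    have h2 := Real.mul_self_sqrt (show 0 ≤ x by linarith)
    simp only [k, Pi.one_apply]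
    field_simp
    nlinarith
  refine ⟨r * v * r, I.mul_mem_right _ _ (I.mul_mem_left _ _ hvI), ?_, ?_, ?_⟩
  · have := star_left_conjugate_nonneg hv0 r
    rwa [hrs] at this
  · have := star_left_conjugate_le_conjugate hvs r
    rwa [hrs, hrsr] at this
  · have := star_left_conjugate_le_conjugate hvE r
    rw [hrs] at this
    rw [hright r hrB, hleft r hrB]
    refine le_trans (le_of_eq ?_) this
    rw [mul_smul_comm, smul_mul_assoc, hrsr, Algebra.algebraMap_eq_smul_one]

lemma aux_ideal_smul (I : TwoSidedIdeal A) (r : ℝ) {x : A} (hx : x ∈ I) : r • x ∈ I := by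
  rw [Algebra.smul_def]; exact I.mul_mem_left _ _ hx

lemma aux_approx [Nontrivial A]
    (B : StarSubalgebra ℂ A) (hB : IsClosed (B : Set A))
    (hBsimple : ∀ I : TwoSidedIdeal B, IsClosed (I : Set B) → I = ⊥ ∨ I = ⊤)
    (E : A →L[ℂ] A)
    (hrange : ∀ x : A, E x ∈ B)
    (hleft : ∀ b ∈ B, ∀ x : A, E (b * x) = b * E x)
    (hright : ∀ b ∈ B, ∀ x : A, E (x * b) = E x * b)
    (hpos : ∀ x : A, 0 ≤ x → 0 ≤ E x)
    (l : ℝ) (hl : 0 < l)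
    (hPP : ∀ x : A, 0 ≤ x → x ≤ l • E x)
    (I : TwoSidedIdeal A) (δ : ℝ) (hδ : 0 < δ) :
    ∃ v ∈ I, 0 ≤ v ∧ v ≤ 1 ∧ ∀ x ∈ I, ‖x * (1 - v)‖ ≤ δ * ‖x‖ ∧ ‖(1 - v) * x‖ ≤ δ * ‖x‖ := by
  let S : Set ℝ := {r | ∃ u ∈ I, 0 ≤ u ∧ u ≤ 1 ∧ r = ‖E u‖}
  have hSb : BddAbove S := by
    refine ⟨‖E‖, ?_⟩
    rintro _ ⟨u, -, h0, h1, rfl⟩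
    have := (CStarAlgebra.norm_le_one_iff_of_nonneg u h0).2 h1
    calc ‖E u‖ ≤ ‖E‖ * ‖u‖ := E.le_opNorm u
      _ ≤ ‖E‖ * 1 := by gcongr
      _ = ‖E‖ := mul_one _
  have hSne : S.Nonempty := ⟨_, 0, I.zero_mem, le_rfl, zero_le_one, rfl⟩
  set c := sSup S with hc
  set ε := δ ^ 2 / l with hε
  have hεpos : 0 < ε := by positivity
  obtain ⟨_, ⟨u, huI, hu0, hu1, rfl⟩, hcu⟩ := exists_lt_of_lt_csSup hSne (show c - ε < sSup S by linarith)
  obtain ⟨v, hvI, hv0, hv1, hvE⟩ := aux_key B hB hBsimple E hrange hleft hright hpos I u huI hu0 hu1 _ hcu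
  let r := CFC.sqrt (1 - v)
  have hr0 : 0 ≤ r := CFC.sqrt_nonneg _
  have hrr : r * r = 1 - v := CFC.sqrt_mul_sqrt_self (1 - v) (sub_nonneg.2 hv1)
  have hrs : star r = r := (IsSelfAdjoint.of_nonneg hr0).star_eq
  have hrn : ‖r‖ ≤ 1 := by
    have h1 : ‖r‖ * ‖r‖ = ‖r * r‖ := by
      rw [← CStarRing.norm_star_mul_self, hrs]
    have h2 : ‖r * r‖ ≤ 1 := by
      rw [hrr]
      exact (CStarAlgebra.norm_le_one_iff_of_nonneg _ (sub_nonneg.2 hv1)).2 (sub_le_self _ hv0)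
    nlinarith [norm_nonneg r]
  have key : ∀ h ∈ I, 0 ≤ h → h ≤ 1 → ‖r * h * r‖ ≤ δ ^ 2 := by
    intro h hI h0 h1
    have k0 : 0 ≤ r * h * r := conjugate_nonneg_of_nonneg h0 hr0
    have k1 : r * h * r ≤ 1 - v := by
      have := conjugate_le_conjugate_of_nonneg h1 hr0
      rwa [mul_one, hrr] at this
    have kI : r * h * r ∈ I := I.mul_mem_right _ _ (I.mul_mem_left _ _ hI)
    have w0 : 0 ≤ v + r * h * r := add_nonneg hv0 k0
    have wc : ‖E (v + r * h * r)‖ ≤ c :=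
      le_csSup hSb ⟨_, I.add_mem hvI kI, w0, by rw [add_comm]; exact le_sub_iff_add_le.1 k1, rfl⟩
    have w1 : E (v + r * h * r) ≤ algebraMap ℝ A c :=
      (aux_le_norm (hpos _ w0)).trans (algebraMap_mono A wc)
    have w2 : E (r * h * r) ≤ algebraMap ℝ A ε := by
      have h3 : E (r * h * r) = E (v + r * h * r) - E v := by rw [map_add]; abel
      rw [h3]
      refine (sub_le_sub w1 hvE).trans (le_of_eq ?_)
      rw [← map_sub]; congr 1; ring
    have w3 : r * h * r ≤ algebraMap ℝ A (δ ^ 2) := by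
      refine (hPP _ k0).trans ((smul_le_smul_of_nonneg_left w2 hl.le).trans (le_of_eq ?_))
      rw [Algebra.smul_def, ← map_mul]; congr 1; rw [hε]; field_simp
    exact (CStarAlgebra.norm_le_iff_le_algebraMap _ (by positivity) k0).2 w3
  have key2 : ∀ h ∈ I, 0 ≤ h → ‖r * h * r‖ ≤ δ ^ 2 * ‖h‖ := by
    intro h hI h0
    by_cases hn : ‖h‖ = 0
    · rw [norm_eq_zero.1 hn]; simp
    · have hn' : 0 < ‖h‖ := lt_of_le_of_ne (norm_nonneg _) (Ne.symm hn)
      have := key (‖h‖⁻¹ • h) (aux_ideal_smul I _ hI) (smul_nonneg (by positivity) h0)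
        ((CStarAlgebra.norm_le_one_iff_of_nonneg _ (smul_nonneg (by positivity) h0)).1
          (by rw [norm_smul, norm_inv, norm_norm, inv_mul_cancel₀ hn]))
      rw [mul_smul_comm, smul_mul_assoc, norm_smul, norm_inv, norm_norm, inv_mul_le_iff₀ hn'] at this
      linarith
  refine ⟨v, hvI, hv0, hv1, fun x hx => ⟨?_, ?_⟩⟩
  · have h1 := key2 (star x * x) (I.mul_mem_left _ _ hx) (star_mul_self_nonneg x)
    have h2 : r * (star x * x) * r = star (x * r) * (x * r) := by
      rw [star_mul, hrs]; noncomm_ring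
    rw [h2, CStarRing.norm_star_mul_self, CStarRing.norm_star_mul_self] at h1
    have h3 : ‖x * r‖ ≤ δ * ‖x‖ := abs_le_of_sq_le_sq' (by nlinarith) (by positivity) |>.2
    rw [← hrr, ← mul_assoc]
    exact (norm_mul_le _ _).trans ((mul_le_of_le_one_right (norm_nonneg _) hrn).trans h3)
  · have h1 := key2 (x * star x) (I.mul_mem_right _ _ hx) (mul_star_self_nonneg x)
    have h2 : r * (x * star x) * r = (r * x) * star (r * x) := by
      rw [star_mul, hrs]; noncomm_ring
    rw [h2, CStarRing.norm_self_mul_star, CStarRing.norm_self_mul_star] at h1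
    have h3 : ‖r * x‖ ≤ δ * ‖x‖ := abs_le_of_sq_le_sq' (by nlinarith) (by positivity) |>.2
    rw [← hrr, mul_assoc]
    exact (norm_mul_le _ _).trans ((mul_le_of_le_one_left (norm_nonneg _) hrn).trans h3)

lemma aux_unit (I : TwoSidedIdeal A) (hI : IsClosed (I : Set A))
    (h : ∀ δ : ℝ, 0 < δ → ∃ v ∈ I, 0 ≤ v ∧ v ≤ 1 ∧
      ∀ x ∈ I, ‖x * (1 - v)‖ ≤ δ * ‖x‖ ∧ ‖(1 - v) * x‖ ≤ δ * ‖x‖) :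
    ∃ p ∈ I, star p = p ∧ IsIdempotentElem p ∧ (∀ a, a * p = p * a) ∧ (∀ x, x ∈ I ↔ x * p = x) := by
  choose v hvI hv0 hv1 hv using fun n : ℕ => h (1 / ((n : ℝ) + 1)) (by positivity)
  have ht : Filter.Tendsto (fun n : ℕ => 1 / ((n : ℝ) + 1)) Filter.atTop (nhds 0) :=
    tendsto_one_div_add_atTop_nhds_zero_nat
  have hanti : ∀ N n : ℕ, N ≤ n → 1 / ((n : ℝ) + 1) ≤ 1 / ((N : ℝ) + 1) := fun N n h =>
    one_div_le_one_div_of_le (by positivity) (by exact_mod_cast Nat.succ_le_succ h)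
  have hn1 : ∀ n, ‖v n‖ ≤ 1 := fun n => (CStarAlgebra.norm_le_one_iff_of_nonneg _ (hv0 n)).2 (hv1 n)
  have hcau : CauchySeq v := by
    refine cauchySeq_of_le_tendsto_0 (fun N : ℕ => 2 * (1 / ((N : ℝ) + 1))) ?_ (by simpa using ht.const_mul 2)
    intro n m N hn hm
    rw [dist_eq_norm]
    have e : v n - v m = v n * (1 - v m) - (1 - v n) * v m := by noncomm_ring
    rw [e]
    have h1 := (hv m (v n) (hvI n)).1
    have h2 := (hv n (v m) (hvI m)).2
    have p1 : 0 ≤ 1 / ((N : ℝ) + 1) := by positivity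
    have h3 : 1 / ((m : ℝ) + 1) * ‖v n‖ ≤ 1 / ((N : ℝ) + 1) * 1 :=
      mul_le_mul (hanti _ _ hm) (hn1 n) (norm_nonneg _) p1
    have h4 : 1 / ((n : ℝ) + 1) * ‖v m‖ ≤ 1 / ((N : ℝ) + 1) * 1 :=
      mul_le_mul (hanti _ _ hn) (hn1 m) (norm_nonneg _) p1
    refine (norm_sub_le _ _).trans ?_
    linarith
  obtain ⟨p, hp⟩ := cauchySeq_tendsto_of_complete hcau
  have hpI : p ∈ I := hI.mem_of_tendsto hp (Filter.Eventually.of_forall hvI)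
  have hps : star p = p := by
    have h1 := (continuous_star.tendsto p).comp hp
    refine tendsto_nhds_unique h1 (hp.congr fun n => ?_)
    exact ((IsSelfAdjoint.of_nonneg (hv0 n)).star_eq).symm
  have hr : ∀ x ∈ I, x * p = x := by
    intro x hx
    have h1 : Filter.Tendsto (fun n => x * (1 - v n)) Filter.atTop (nhds (x * (1 - p))) :=
      (hp.const_sub 1).const_mul x
    have h2 : Filter.Tendsto (fun n => x * (1 - v n)) Filter.atTop (nhds 0) :=
      squeeze_zero_norm (fun n => (hv n x hx).1) (by simpa using ht.mul_const ‖x‖)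
    have := tendsto_nhds_unique h1 h2
    rw [mul_sub, mul_one, sub_eq_zero] at this
    exact this.symm
  have hl : ∀ x ∈ I, p * x = x := by
    intro x hx
    have h1 : Filter.Tendsto (fun n => (1 - v n) * x) Filter.atTop (nhds ((1 - p) * x)) :=
      (hp.const_sub 1).mul_const x
    have h2 : Filter.Tendsto (fun n => (1 - v n) * x) Filter.atTop (nhds 0) :=
      squeeze_zero_norm (fun n => (hv n x hx).2) (by simpa using ht.mul_const ‖x‖)
    have := tendsto_nhds_unique h1 h2
    rw [sub_mul, one_mul, sub_eq_zero] at this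
    exact this.symm
  refine ⟨p, hpI, hps, hr p hpI, fun a => ?_, fun x => ⟨hr x, fun hx => ?_⟩⟩
  · have h1 := hl (a * p) (I.mul_mem_left _ _ hpI)
    have h2 := hr (p * a) (I.mul_mem_right _ _ hpI)
    rw [← h1, ← mul_assoc, h2]
  · rw [← hx]; exact I.mul_mem_left _ _ hpI

lemma aux_comm_nonunit {Z : Type*} [NormedCommRing Z] [NormedAlgebra ℂ Z] [CompleteSpace Z]
    (h z : Z) (hz : z * z = z) (hz0 : z ≠ 0) :
    ∃ μ : ℂ, ¬ IsUnit ((h - algebraMap ℂ Z μ) * z + (1 - z)) := by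
  have h1 : ¬ IsUnit (1 - z) := by
    intro hu
    apply hz0
    have : (1 - z) * z = 0 := by rw [sub_mul, one_mul, hz, sub_self]
    exact (hu.mul_right_eq_zero).1 this
  obtain ⟨φ, hφ⟩ := WeakDual.CharacterSpace.exists_apply_eq_zero h1
  refine ⟨φ h, fun hu => ?_⟩
  have h2 : IsUnit (φ ((h - algebraMap ℂ Z (φ h)) * z + (1 - z))) := hu.map φ
  rw [map_add, hφ, map_mul, map_sub, AlgHomClass.commutes] at h2
  simp at h2

lemma aux_nonunit {A : Type*} [NormedRing A] [NormedAlgebra ℂ A] [CompleteSpace A]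
    (h z : A) (hh : ∀ a, a * h = h * a) (hzc : ∀ a, a * z = z * a)
    (hz : z * z = z) (hz0 : z ≠ 0) :
    ∃ μ : ℂ, ¬ IsUnit ((h - algebraMap ℂ A μ) * z + (1 - z)) := by
  let Z := Subalgebra.center ℂ A
  letI : NormedCommRing Z := { (inferInstance : NormedRing Z) with mul_comm := mul_comm }
  have hcl : IsClosed (Z : Set A) := by
    have : (Z : Set A) = Set.centralizer Set.univ := by
      rw [Set.centralizer_univ]; rfl
    rw [this]; exact Set.isClosed_centralizer _
  haveI : CompleteSpace Z := hcl.completeSpace_coe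
  have hmem : ∀ x : A, (∀ a, a * x = x * a) → x ∈ Z := fun x hx =>
    Subalgebra.mem_center_iff.2 fun a => hx a
  obtain ⟨μ, hμ⟩ := aux_comm_nonunit (Z := Z) ⟨h, hmem h hh⟩ ⟨z, hmem z hzc⟩ (Subtype.ext hz)
    (fun h0 => hz0 (congrArg Subtype.val h0))
  refine ⟨μ, fun hu => hμ ?_⟩
  let w : Z := (⟨h, hmem h hh⟩ - algebraMap ℂ Z μ) * ⟨z, hmem z hzc⟩ + (1 - ⟨z, hmem z hzc⟩)
  have hw : (w : A) = (h - algebraMap ℂ A μ) * z + (1 - z) := rfl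
  obtain ⟨y, hy⟩ := hu
  rw [← hw] at hy
  have hyc : ∀ a, a * (↑y⁻¹ : A) = ↑y⁻¹ * a := by
    intro a
    have h1 : Commute a (y : A) := by
      rw [hy]; exact Subalgebra.mem_center_iff.1 w.2 a
    exact h1.units_inv_right
  refine IsUnit.of_mul_eq_one (⟨_, hmem _ hyc⟩ : Z) (Subtype.ext ?_)
  change (w : A) * (↑y⁻¹ : A) = 1
  rw [← hy]; simp

structure AuxCP (p : A) : Prop where
  comm : ∀ a, a * p = p * a
  idem : p * p = p
  sa : star p = p
  
structure AuxGood (F : Finset A) : Prop where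
  cp : ∀ p ∈ F, AuxCP p
  ne : ∀ p ∈ F, p ≠ 0
  orth : ∀ p ∈ F, ∀ q ∈ F, p ≠ q → p * q = 0
  sum : ∑ p ∈ F, p = 1

lemma AuxCP.compl {p : A} (hp : AuxCP p) : AuxCP (1 - p) := by
  refine ⟨fun a => ?_, ?_, ?_⟩
  · rw [mul_sub, sub_mul, hp.comm]; simp
  · rw [mul_sub, sub_mul, sub_mul, hp.idem]; simp
  · simp [hp.sa]

lemma AuxCP.mul {p q : A} (hp : AuxCP p) (hq : AuxCP q) : AuxCP (p * q) := by
  refine ⟨fun a => ?_, ?_, ?_⟩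
  · rw [← mul_assoc, hp.comm, mul_assoc, hq.comm, mul_assoc]
  · rw [mul_assoc, ← mul_assoc q, hp.comm q, mul_assoc, hq.idem, ← mul_assoc, hp.idem]
  · rw [star_mul, hp.sa, hq.sa, hp.comm]

lemma AuxCP.nonneg {p : A} (hp : AuxCP p) : 0 ≤ p := by
  have := star_mul_self_nonneg p
  rwa [hp.sa, hp.idem] at this

lemma AuxCP.le_one {p : A} (hp : AuxCP p) : p ≤ 1 := sub_nonneg.1 hp.compl.nonneg

lemma aux_lower [Nontrivial A]
    (B : StarSubalgebra ℂ A) (hB : IsClosed (B : Set A))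
    (hBsimple : ∀ I : TwoSidedIdeal B, IsClosed (I : Set B) → I = ⊥ ∨ I = ⊤)
    (E : A →L[ℂ] A)
    (hrange : ∀ x : A, E x ∈ B)
    (hleft : ∀ b ∈ B, ∀ x : A, E (b * x) = b * E x)
    (hright : ∀ b ∈ B, ∀ x : A, E (x * b) = E x * b)
    (hpos : ∀ x : A, 0 ≤ x → 0 ≤ E x)
    (l : ℝ) (hl : 0 < l)
    (hPP : ∀ x : A, 0 ≤ x → x ≤ l • E x) (p : A) (hp : AuxCP p) (hp0 : p ≠ 0) :
    algebraMap ℝ A (1 / (2 * l)) ≤ E p := by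
  let I : TwoSidedIdeal A := TwoSidedIdeal.mk' {x | x * p = x} (by simp)
    (fun {x y} hx hy => by simp only [Set.mem_ofPred_eq] at *; rw [add_mul, hx, hy])
    (fun {x} hx => by simp only [Set.mem_ofPred_eq] at *; rw [neg_mul, hx])
    (fun {x y} hx => by simp only [Set.mem_ofPred_eq] at *; rw [mul_assoc, hx])
    (fun {x y} hx => by simp only [Set.mem_ofPred_eq] at *; rw [mul_assoc, hp.comm, ← mul_assoc, hx])
  have hI : ∀ x, x ∈ I ↔ x * p = x := fun x => by simp [I]
  have hn : ‖p‖ = 1 := by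
    have := CStarRing.norm_star_mul_self (x := p)
    rw [hp.sa, hp.idem] at this
    have h0 : ‖p‖ ≠ 0 := norm_ne_zero_iff.2 hp0
    exact (mul_left_cancel₀ h0 (by rw [← this, mul_one])).symm
  have h1 : 1 ≤ l * ‖E p‖ := by
    have := CStarAlgebra.norm_le_norm_of_nonneg_of_le hp.nonneg (hPP p hp.nonneg)
    rwa [hn, norm_smul, Real.norm_of_nonneg hl.le] at this
  have h2 : 1 / (2 * l) < ‖E p‖ := by
    rw [div_lt_iff₀ (by positivity)]; nlinarith
  obtain ⟨v, hvI, hv0, hv1, hvE⟩ := aux_key B hB hBsimple E hrange hleft hright hpos I p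
    ((hI p).2 hp.idem) hp.nonneg hp.le_one _ h2
  refine hvE.trans ?_
  have h3 : v ≤ p := by
    have := conjugate_le_conjugate_of_nonneg hv1 hp.nonneg
    rw [mul_one, hp.idem, mul_assoc, (hI v).1 hvI, ← hp.comm, (hI v).1 hvI] at this
    exact this
  have := hpos _ (sub_nonneg.2 h3)
  rwa [map_sub, sub_nonneg] at this

lemma aux_split [DecidableEq A] {F : Finset A} (hF : AuxGood F)
    (hmax : ∀ F' : Finset A, AuxGood F' → F'.card ≤ F.card)
    (z : A) (hz : z ∈ F) (p : A) (hp : AuxCP p) : z * p = 0 ∨ z * p = z := by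
  by_contra! hcon
  obtain ⟨h0, h1⟩ := hcon
  have hzc := hF.cp z hz
  set a := z * p with ha
  set b := z * (1 - p) with hb
  have ca : AuxCP a := hzc.mul hp
  have cb : AuxCP b := hzc.mul hp.compl
  have hb0 : b ≠ 0 := by
    intro h; apply h1
    rw [hb, mul_sub, mul_one, sub_eq_zero] at h
    exact h.symm
  have hab : a * b = 0 := by
    rw [ha, hb, mul_assoc, ← mul_assoc p, hzc.comm p, mul_assoc z p, mul_sub, mul_one, hp.idem]; simp
  have hba : b * a = 0 := by rw [← cb.comm, hab]
  have hsum : a + b = z := by rw [ha, hb]; noncomm_ring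
  have oa : ∀ q ∈ F.erase z, a * q = 0 := by
    intro q hq
    rw [Finset.mem_erase] at hq
    rw [ha, mul_assoc, ← hp.comm, ← mul_assoc, hF.orth z hz q hq.2 (Ne.symm hq.1), zero_mul]
  have ob : ∀ q ∈ F.erase z, b * q = 0 := by
    intro q hq
    rw [Finset.mem_erase] at hq
    rw [hb, mul_assoc, ← hp.compl.comm, ← mul_assoc, hF.orth z hz q hq.2 (Ne.symm hq.1), zero_mul]
  have nb : b ∉ F.erase z := fun h => hb0 (by rw [← cb.idem]; exact ob b h)
  have na : a ∉ insert b (F.erase z) := by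
    rw [Finset.mem_insert]
    rintro (h | h)
    · apply h0; rw [← ca.idem]; nth_rewrite 2 [h]; exact hab
    · exact h0 (by rw [← ca.idem]; exact oa a h)
  have good : AuxGood (insert a (insert b (F.erase z))) := by
    have hmem : ∀ q ∈ insert a (insert b (F.erase z)), q = a ∨ q = b ∨ q ∈ F.erase z := by
      intro q hq; simpa only [Finset.mem_insert] using hq
    have hcp : ∀ q ∈ insert a (insert b (F.erase z)), AuxCP q := by
      intro q hq
      rcases hmem q hq with rfl | rfl | h
      · exact ca
      · exact cb
      · exact hF.cp q (Finset.mem_of_mem_erase h)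
    refine ⟨hcp, ?_, ?_, ?_⟩
    · intro q hq
      rcases hmem q hq with h | h | h
      · rw [h]; exact h0
      · rw [h]; exact hb0
      · exact hF.ne q (Finset.mem_of_mem_erase h)
    · intro q hq r hr hqr
      have cr := hcp r hr
      rcases hmem q hq with h | h | h <;> rcases hmem r hr with h' | h' | h'
      · exact absurd (h.trans h'.symm) hqr
      · rw [h, h', hab]
      · rw [h, oa r h']
      · rw [h, h', hba]
      · exact absurd (h.trans h'.symm) hqr
      · rw [h, ob r h']
      · rw [cr.comm, h', oa q h]
      · rw [cr.comm, h', ob q h]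
      · exact hF.orth q (Finset.mem_of_mem_erase h) r (Finset.mem_of_mem_erase h') hqr
    · rw [Finset.sum_insert na, Finset.sum_insert nb, ← add_assoc, hsum, Finset.add_sum_erase F (fun x => x) hz]
      exact hF.sum
  have := hmax _ good
  rw [Finset.card_insert_of_notMem na, Finset.card_insert_of_notMem nb, Finset.card_erase_of_mem hz] at this
  have : 0 < F.card := Finset.card_pos.2 ⟨z, hz⟩
  omega

theorem aux_main [Nontrivial A]
    (B : StarSubalgebra ℂ A) (hB : IsClosed (B : Set A))
    (hBsimple : ∀ I : TwoSidedIdeal B, IsClosed (I : Set B) → I = ⊥ ∨ I = ⊤)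
    (E : A →L[ℂ] A)
    (hrange : ∀ x : A, E x ∈ B)
    (hfix : ∀ b ∈ B, E b = b)
    (hleft : ∀ b ∈ B, ∀ x : A, E (b * x) = b * E x)
    (hright : ∀ b ∈ B, ∀ x : A, E (x * b) = E x * b)
    (hpos : ∀ x : A, 0 ≤ x → 0 ≤ E x)
    (l : ℝ) (hl : 0 < l)
    (hPP' : ∀ x : A, 0 ≤ x → x ≤ (l : ℂ) • E x) :
    FiniteDimensional ℂ (Subalgebra.center ℂ A) ∧
    ∃ (n : ℕ) (z : Fin n → A),
      (∀ i, z i ∈ Set.center A) ∧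
      (∀ i, IsIdempotentElem (z i)) ∧
      (∀ i, star (z i) = z i) ∧
      (∀ i, z i ≠ 0) ∧
      (∀ i j, i ≠ j → z i * z j = 0) ∧
      (∑ i, z i) = 1 ∧
      (∀ J : TwoSidedIdeal A, IsClosed (J : Set A) →
        ∃ S : Finset (Fin n), (J : Set A) = {a : A | a * (∑ i ∈ S, z i) = a}) := by
  classical
  have hPP : ∀ x : A, 0 ≤ x → x ≤ l • E x := fun x hx => by
    simpa only [Complex.coe_smul] using hPP' x hx
  have hunit : ∀ I : TwoSidedIdeal A, IsClosed (I : Set A) →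
      ∃ p : A, AuxCP p ∧ ∀ x, x ∈ I ↔ x * p = x := by
    intro I hI
    obtain ⟨p, -, h1, h2, h3, h4⟩ := aux_unit I hI
      (aux_approx B hB hBsimple E hrange hleft hright hpos l hl hPP I)
    exact ⟨p, ⟨h3, h2, h1⟩, h4⟩
  have hbound : ∀ F : Finset A, AuxGood F → (F.card : ℝ) ≤ 2 * l := by
    intro F hF
    have h1 : ∑ p ∈ F, algebraMap ℝ A (1 / (2 * l)) ≤ ∑ p ∈ F, E p :=
      Finset.sum_le_sum fun p hp =>
        aux_lower B hB hBsimple E hrange hleft hright hpos l hl hPP p (hF.cp p hp) (hF.ne p hp)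
    rw [← map_sum E (fun p => p) F, hF.sum, hfix 1 (one_mem B), Finset.sum_const, ← map_nsmul] at h1
    have h2 := (CStarAlgebra.norm_le_one_iff_of_nonneg _
      (by rw [← map_zero (algebraMap ℝ A)]; exact algebraMap_mono A (by positivity))).2 h1
    rw [norm_algebraMap', nsmul_eq_mul, Real.norm_of_nonneg (by positivity), mul_one_div,
      div_le_one (by positivity)] at h2
    exact h2
  have good1 : AuxGood ({1} : Finset A) := by
    refine ⟨?_, ?_, ?_, ?_⟩
    · intro p hp; rw [Finset.mem_singleton.1 hp]; exact ⟨by simp, by simp, by simp⟩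
    · intro p hp; rw [Finset.mem_singleton.1 hp]; exact one_ne_zero
    · intro p hp q hq h
      exact absurd ((Finset.mem_singleton.1 hp).trans (Finset.mem_singleton.1 hq).symm) h
    · simp
  obtain ⟨F, hF, hmax⟩ : ∃ F : Finset A, AuxGood F ∧ ∀ F' : Finset A, AuxGood F' → F'.card ≤ F.card := by
    let N : Set ℕ := {n | ∃ F : Finset A, AuxGood F ∧ F.card = n}
    have hN : N.Nonempty := ⟨_, _, good1, rfl⟩
    have hNb : BddAbove N := by
      refine ⟨⌈2 * l⌉₊, ?_⟩
      rintro _ ⟨F, hF, rfl⟩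
      exact_mod_cast (hbound F hF).trans (Nat.le_ceil _)
    obtain ⟨F, hF, h⟩ := Nat.sSup_mem hN hNb
    exact ⟨F, hF, fun F' hF' => by rw [h]; exact le_csSup hNb ⟨F', hF', rfl⟩⟩
  have hsplit := aux_split hF hmax
  constructor
  · -- finite-dimensionality of the center
    have hscal : ∀ h : A, (∀ a, a * h = h * a) → ∀ z ∈ F, ∃ μ : ℂ, h * z = μ • z := by
      intro h hh z hz
      have cz := hF.cp z hz
      obtain ⟨μ, hμ⟩ := aux_nonunit h z hh cz.comm cz.idem (hF.ne z hz)
      refine ⟨μ, ?_⟩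
      set w := (h - algebraMap ℂ A μ) * z + (1 - z) with hw
      have hwc : ∀ a, a * w = w * a := by
        intro a
        have c1 : Commute a (h - algebraMap ℂ A μ) :=
          (show Commute a h from hh a).sub_right (Algebra.commutes μ a).symm
        exact ((c1.mul_right (cz.comm a)).add_right (cz.compl.comm a))
      let C : Set A := Set.range (fun x => x * w)
      let J : TwoSidedIdeal A := TwoSidedIdeal.mk' (closure C)
        (subset_closure ⟨0, by simp⟩)
        (fun hx hy => map_mem_closure₂ continuous_add hx hy (by
          rintro _ ⟨x, rfl⟩ _ ⟨y, rfl⟩; exact ⟨x + y, add_mul _ _ _⟩))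
        (fun {x} hx => map_mem_closure continuous_neg hx (by
          rintro _ ⟨x, rfl⟩; exact ⟨-x, neg_mul _ _⟩))
        (fun {x y} hy => map_mem_closure (f := fun t => x * t) (continuous_const_mul x) hy (by
          rintro _ ⟨a, rfl⟩; exact ⟨x * a, mul_assoc _ _ _⟩))
        (fun {x y} hx => map_mem_closure (f := fun t => t * y) (continuous_mul_const y) hx (by
          rintro _ ⟨a, rfl⟩
          exact ⟨a * y, by simp only []; rw [mul_assoc, hwc, mul_assoc]⟩))
      have hJ : (J : Set A) = closure C := TwoSidedIdeal.coe_mk' ..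
      obtain ⟨p, hp, hpJ⟩ := hunit J (by rw [hJ]; exact isClosed_closure)
      have hwJ : w ∈ J := by
        change w ∈ (J : Set A)
        rw [hJ]; exact subset_closure ⟨1, one_mul _⟩
      have hp1 : p ≠ 1 := by
        intro h1
        have h2 : (1 : A) ∈ (J : Set A) := (hpJ 1).2 (by rw [h1, one_mul])
        rw [hJ] at h2
        obtain ⟨_, ⟨x, rfl⟩, hx⟩ := Metric.mem_closure_iff.1 h2 1 one_pos
        rw [dist_eq_norm] at hx
        have hu : IsUnit (x * w) := by
          have := isUnit_one_sub_of_norm_lt_one hx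
          simpa using this
        exact hμ ((show Commute x w from hwc x).isUnit_mul_iff.1 hu).2
      have hwp : w * p = w := (hpJ w).1 hwJ
      have hw1 : w * (1 - z) = 1 - z := by
        rw [hw, add_mul, cz.compl.idem, mul_assoc, mul_sub, mul_one, cz.idem]; simp
      have hwz : w * z = (h - algebraMap ℂ A μ) * z := by
        have h2 : (1 - z) * z = 0 := by rw [sub_mul, one_mul, cz.idem, sub_self]
        rw [hw, add_mul, mul_assoc, cz.idem, h2, add_zero]
      have hzp : (1 - z) * p = 1 - z := by
        conv_lhs => rw [← hw1]
        rw [mul_assoc, hp.comm (1 - z), ← mul_assoc, hwp, hw1]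
      rcases hsplit z hz p hp with h0 | h0
      · have : w * z = 0 := by rw [← hwp, mul_assoc, cz.comm p, h0, mul_zero]
        rw [hwz, sub_mul, sub_eq_zero, ← Algebra.smul_def] at this
        exact this
      · exfalso; apply hp1
        rw [sub_mul, one_mul, h0] at hzp
        exact sub_left_injective hzp
    have hle : Subalgebra.toSubmodule (Subalgebra.center ℂ A) ≤ Submodule.span ℂ (F : Set A) := by
      intro h hh
      have hh' : ∀ a, a * h = h * a := (Subalgebra.mem_center_iff (R := ℂ)).1 hh
      rw [← mul_one h, ← hF.sum, Finset.mul_sum]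
      refine Submodule.sum_mem _ fun z hz => ?_
      obtain ⟨μ, hμ⟩ := hscal h hh' z hz
      rw [hμ]
      exact Submodule.smul_mem _ _ (Submodule.subset_span hz)
    haveI : FiniteDimensional ℂ (Submodule.span ℂ (F : Set A)) :=
      FiniteDimensional.span_finset ℂ F
    exact Submodule.finiteDimensional_of_le hle
  · let e := F.equivFin
    let z : Fin F.card → A := fun i => (e.symm i : A)
    have hzF : ∀ i, z i ∈ F := fun i => (e.symm i).2
    have hzsum : ∑ i, z i = 1 := by
      rw [← hF.sum, ← Finset.sum_coe_sort F (fun x => x)]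
      exact Equiv.sum_comp e.symm (fun x : F => (x : A))
    refine ⟨F.card, z, fun i => ?_, fun i => (hF.cp _ (hzF i)).idem, fun i => (hF.cp _ (hzF i)).sa,
      fun i => hF.ne _ (hzF i), fun i j hij => ?_, hzsum, fun J hJ => ?_⟩
    · rw [Semigroup.mem_center_iff]; exact (hF.cp _ (hzF i)).comm
    · refine hF.orth _ (hzF i) _ (hzF j) fun h => hij ?_
      exact e.symm.injective (Subtype.ext h)
    · obtain ⟨p, hp, hpJ⟩ := hunit J hJ
      refine ⟨Finset.univ.filter fun i => z i * p = z i, ?_⟩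
      have : ∑ i ∈ Finset.univ.filter (fun i => z i * p = z i), z i = p := by
        rw [Finset.sum_filter]
        conv_rhs => rw [← one_mul p, ← hzsum, Finset.sum_mul]
        refine Finset.sum_congr rfl fun i _ => ?_
        split_ifs with h
        · exact h.symm
        · exact ((hsplit _ (hzF i) p hp).resolve_right h).symm
      rw [this]
      ext x
      exact hpJ x
end helpers


/-- Let `A ⊃ B` be unital C*-algebras with a conditional
expectation `E : A → B` satisfying `x ≤ l • E x` for positive `x`.  If `B` is
simple, then the center of `A` is finite dimensional and `A` is a finite
direct sum of simple closed two-sided ideals: there are finitely many nonzero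
pairwise orthogonal selfadjoint central projections `z i` summing to `1` such
that every closed two-sided ideal of `A` is the sum of some of the blocks
`A (z i)`. -/
theorem stmt_10 {A : Type*} [NormedRing A] [StarRing A] [CStarRing A] [NormedAlgebra ℂ A]
    [StarModule ℂ A] [CompleteSpace A] [PartialOrder A] [StarOrderedRing A] [Nontrivial A]
    (B : StarSubalgebra ℂ A) (hB : IsClosed (B : Set A))
    (hBsimple : ∀ I : TwoSidedIdeal B, IsClosed (I : Set B) → I = ⊥ ∨ I = ⊤)
    (E : A →L[ℂ] A)
    (hrange : ∀ x : A, E x ∈ B)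
    (hfix : ∀ b ∈ B, E b = b)
    (hleft : ∀ b ∈ B, ∀ x : A, E (b * x) = b * E x)
    (hright : ∀ b ∈ B, ∀ x : A, E (x * b) = E x * b)
    (hpos : ∀ x : A, 0 ≤ x → 0 ≤ E x)
    (l : ℝ) (hl : 0 < l)
    (hPP : ∀ x : A, 0 ≤ x → x ≤ (l : ℂ) • E x) :
    FiniteDimensional ℂ (Subalgebra.center ℂ A) ∧
    ∃ (n : ℕ) (z : Fin n → A),
      (∀ i, z i ∈ Set.center A) ∧
      (∀ i, IsIdempotentElem (z i)) ∧
      (∀ i, star (z i) = z i) ∧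
      (∀ i, z i ≠ 0) ∧
      (∀ i j, i ≠ j → z i * z j = 0) ∧
      (∑ i, z i) = 1 ∧
      (∀ J : TwoSidedIdeal A, IsClosed (J : Set A) →
        ∃ S : Finset (Fin n), (J : Set A) = {a : A | a * (∑ i ∈ S, z i) = a}) := by
  letI : CStarAlgebra A := {}
  exact aux_main B hB hBsimple E hrange hfix hleft hright hpos l hl hPP
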